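/- Let ΔL = L̂ − L be the deviation of the Laplacian of the edge-subsampled graph (each edge retained independently with probability p_s ∈ (0,1]) from the original Laplacian L of a simple graph on n vertices. Then for every η ∈ (0,1), with probability at least 1 − η, ‖ΔL‖₂ ≤ (1 − p_s)‖L‖₂ + √(4 p_s(1 − p_s)‖L‖₂ log(2n/η)) + (4/3) log(2n/η). -/

import Mathlib

open MeasureTheory ProbabilityTheory Finset
open scoped Classical

/-- Spectral (ℓ²-operator) norm of a real square matrix. -/
noncomputable def specNorm {n : ℕ} (M : Matrix (Fin n) (Fin n) ℝ) : ℝ :=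
  ‖Matrix.toEuclideanCLM (𝕜 := ℝ) M‖

/-- Euclidean (ℓ²) norm of a vector in ℝⁿ. -/
noncomputable def evNorm {n : ℕ} (u : Fin n → ℝ) : ℝ :=
  Real.sqrt (∑ i, (u i) ^ 2)

/-- The rank-one matrix (e_i − e_j)(e_i − e_j)ᵀ, where e_k is the k-th standard basis vector. -/
noncomputable def edgeMat {n : ℕ} (i j : Fin n) : Matrix (Fin n) (Fin n) ℝ :=
  Matrix.vecMulVec (fun k => (if k = i then (1 : ℝ) else 0) - (if k = j then 1 else 0))
    (fun k => (if k = i then (1 : ℝ) else 0) - (if k = j then 1 else 0))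

/-- Combinatorial graph Laplacian L = D − A. -/
noncomputable def lap {n : ℕ} (A : Matrix (Fin n) (Fin n) ℝ) : Matrix (Fin n) (Fin n) ℝ :=
  Matrix.diagonal (fun i => ∑ j, A i j) - A

/-- All index pairs (i, j) with i < j. -/
noncomputable def pairs (n : ℕ) : Finset (Fin n × Fin n) :=
  Finset.univ.filter (fun p => p.1 < p.2)

/-- Laplacian of the edge-subsampled graph: L̂(ω) = Σ_{i<j} A_{ij} B_{ij}(ω) (e_i−e_j)(e_i−e_j)ᵀ. -/
noncomputable def lapHat {n : ℕ} (A : Matrix (Fin n) (Fin n) ℝ) {Ω : Type*}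
    (B : Fin n → Fin n → Ω → ℝ) (ω : Ω) : Matrix (Fin n) (Fin n) ℝ :=
  ∑ p ∈ pairs n, (A p.1 p.2 * B p.1 p.2 ω) • edgeMat p.1 p.2

/-- One-layer GCN output σ((h₀ I + h₁ M) x), with σ applied elementwise. -/
noncomputable def gcnOut {n : ℕ} (σ : ℝ → ℝ) (h0 h1 : ℝ) (x : Fin n → ℝ)
    (M : Matrix (Fin n) (Fin n) ℝ) : Fin n → ℝ :=
  fun i => σ (((h0 • (1 : Matrix (Fin n) (Fin n) ℝ) + h1 • M).mulVec x) i)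

/-- ±1 labels by thresholding at level τ. -/
noncomputable def thLabels {n : ℕ} (f : Fin n → ℝ) (τ : ℝ) : Fin n → ℝ :=
  fun i => if τ < f i then 1 else -1

/-- Hamming distance between two label vectors. -/
noncomputable def ham {n : ℕ} (y z : Fin n → ℝ) : ℕ :=
  (Finset.univ.filter (fun i => y i ≠ z i)).card

/-- Centered edge-subsampling matrix Y_{ij} = A_{ij}(B_{ij} − p_s)(e_i−e_j)(e_i−e_j)ᵀ. -/
noncomputable def Ymat {n : ℕ} (A : Matrix (Fin n) (Fin n) ℝ) (ps : ℝ) {Ω : Type*}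
    (B : Fin n → Fin n → Ω → ℝ) (i j : Fin n) (ω : Ω) : Matrix (Fin n) (Fin n) ℝ :=
  (A i j * (B i j ω - ps)) • edgeMat i j

/-- The matrix X_{ij} = A_{ij}(B_{ij} − 1)(e_i−e_j)(e_i−e_j)ᵀ. -/
noncomputable def Xmat {n : ℕ} (A : Matrix (Fin n) (Fin n) ℝ) {Ω : Type*}
    (B : Fin n → Fin n → Ω → ℝ) (i j : Fin n) (ω : Ω) : Matrix (Fin n) (Fin n) ℝ :=
  (A i j * (B i j ω - 1)) • edgeMat i j

/-- Entrywise expectation of a random matrix. -/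
noncomputable def matExp {n : ℕ} {Ω : Type*} [MeasurableSpace Ω] (μ : Measure Ω)
    (M : Ω → Matrix (Fin n) (Fin n) ℝ) : Matrix (Fin n) (Fin n) ℝ :=
  Matrix.of fun k l => ∫ ω, M ω k l ∂μ

/-- The single-subsample misclassification bound f(p_s, η). -/
noncomputable def fBound {n : ℕ} (L : Matrix (Fin n) (Fin n) ℝ) (Cσ h1 γmin ps η : ℝ) : ℝ :=
  Cσ * |h1| / (Real.sqrt n * γmin) *
    ((1 - ps) * specNorm L
      + Real.sqrt (4 * ps * (1 - ps) * specNorm L * Real.log (2 * n / η))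
      + 4 / 3 * Real.log (2 * n / η))

/-- Coordinatewise majority vote of m label vectors. -/
noncomputable def majority {n : ℕ} (m : ℕ) (ys : ℕ → Fin n → ℝ) : Fin n → ℝ :=
  fun i => if (m : ℝ) < 2 * (((Finset.range m).filter (fun ℓ => ys ℓ i = 1)).card : ℝ)
    then 1 else -1

set_option linter.unusedSectionVars false

section OperatorLemmas

open NormedSpace InnerProductSpace

variable {E : Type*} [NormedAddCommGroup E] [InnerProductSpace ℝ E] [FiniteDimensional ℝ E]

/-- The exponential of an operator acts on an eigenvector by the exponential of the eigenvalue. -/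
lemma exp_apply_eig (T : E →L[ℝ] E) (v : E) (l : ℝ) (h : T v = l • v) :
    (exp T) v = Real.exp l • v := by
  have hp : ∀ k : ℕ, (T ^ k) v = l ^ k • v := by
    intro k
    induction k with
    | zero => simp
    | succ k ih =>
      rw [pow_succ, mul_apply_eq_comp, h, map_smul, ih, smul_smul, pow_succ, mul_comm]
  have h1 := exp_series_hasSum_exp' (𝕂 := ℝ) T
  have h2 := (ContinuousLinearMap.apply ℝ E v).hasSum h1
  have h3 := (exp_series_hasSum_exp' (𝕂 := ℝ) l).smul_const v
  rw [← Real.exp_eq_exp_ℝ] at h3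
  refine h2.unique ?_
  convert h3 using 2 with k
  simp [hp, smul_smul]

/-- Diagonalisation of the quadratic form of `exp (t T)`. -/
lemma exp_spectral (T : E →L[ℝ] E) (hT : (T : E →ₗ[ℝ] E).IsSymmetric) :
    ∃ (b : OrthonormalBasis (Fin (Module.finrank ℝ E)) ℝ E)
      (l : Fin (Module.finrank ℝ E) → ℝ),
      (∀ i, T (b i) = l i • b i) ∧
      (∀ x, inner ℝ x (T x) = ∑ i, l i * (inner ℝ (b i) x) ^ 2) ∧
      (∀ (t : ℝ) i, exp (t • T) (b i) = Real.exp (t * l i) • b i) ∧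
      (∀ (t : ℝ) x, inner ℝ x (exp (t • T) x) =
        ∑ i, Real.exp (t * l i) * (inner ℝ (b i) x) ^ 2) := by
  refine ⟨hT.eigenvectorBasis rfl, hT.eigenvalues rfl, ?_⟩
  set b := hT.eigenvectorBasis rfl
  set l := hT.eigenvalues rfl
  have h1 : ∀ i, T (b i) = l i • b i := fun i => by
    exact hT.apply_eigenvectorBasis rfl i
  have h3 : ∀ (t : ℝ) i, exp (t • T) (b i) = Real.exp (t * l i) • b i := fun t i => by
    apply exp_apply_eig
    simp [h1, smul_smul]
  have key : ∀ (S : E →L[ℝ] E) (c : Fin (Module.finrank ℝ E) → ℝ), (∀ i, S (b i) = c i • b i) →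
      ∀ x, inner ℝ x (S x) = ∑ i, c i * (inner ℝ (b i) x) ^ 2 := by
    intro S c hS x
    conv_lhs => rw [← b.sum_repr' x]
    simp only [map_sum, map_smul, hS]
    rw [b.sum_repr' x, inner_sum]
    refine Finset.sum_congr rfl fun i _ => ?_
    rw [inner_smul_right, inner_smul_right, real_inner_comm]
    ring
  exact ⟨h1, key _ _ h1, h3, fun t => key _ _ (h3 t)⟩

lemma jensen_exp (T : E →L[ℝ] E) (hT : (T : E →ₗ[ℝ] E).IsSymmetric) (u : E) (hu : ‖u‖ = 1) :
    Real.exp (inner ℝ u (T u)) ≤ inner ℝ u (exp T u) := by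
  obtain ⟨b, l, -, h2, -, h4⟩ := exp_spectral T hT
  have h4 := h4 1 u
  rw [one_smul] at h4
  rw [h2, h4]
  have := convexOn_exp.map_sum_le (t := Finset.univ) (w := fun i => (inner ℝ (b i) u) ^ 2)
    (p := l) (fun i _ => sq_nonneg _) (by rw [b.sum_sq_inner_right, hu]; norm_num) (by simp)
  simpa [mul_comm] using this

lemma exp_quad_pos (T : E →L[ℝ] E) (hT : (T : E →ₗ[ℝ] E).IsSymmetric) (u : E) (hu : ‖u‖ = 1) :
    0 < inner ℝ u (exp T u) :=
  (Real.exp_pos _).trans_le (jensen_exp T hT u hu)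

lemma exp_quad_rpow (T : E →L[ℝ] E) (hT : (T : E →ₗ[ℝ] E).IsSymmetric) (u : E) (hu : ‖u‖ = 1)
    (t : ℝ) (ht0 : 0 ≤ t) (ht1 : t ≤ 1) :
    inner ℝ u (exp (t • T) u) ≤ (inner ℝ u (exp T u)) ^ t := by
  obtain ⟨b, l, -, h2, -, h4⟩ := exp_spectral T hT
  have h41 := h4 1 u
  rw [one_smul] at h41
  rw [h41, h4]
  have := (Real.concaveOn_rpow ht0 ht1).le_map_sum (t := Finset.univ)
    (w := fun i => (inner ℝ (b i) u) ^ 2)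
    (p := fun i => Real.exp (l i)) (fun i _ => sq_nonneg _)
    (by rw [b.sum_sq_inner_right, hu]; norm_num) (fun i _ => (Real.exp_pos _).le)
  simp only [smul_eq_mul, ← Real.exp_mul] at this
  simpa [mul_comm] using this

/-- The trace of the exponential. -/
noncomputable def trExp (T : E →L[ℝ] E) : ℝ := LinearMap.trace ℝ E (exp T : E →L[ℝ] E)

lemma trExp_eq {ι : Type*} [Fintype ι] (T : E →L[ℝ] E) (b : OrthonormalBasis ι ℝ E) :
    trExp T = ∑ i, inner ℝ (b i) (exp T (b i)) :=
  LinearMap.trace_eq_sum_inner _ b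

lemma continuous_trExp : Continuous (trExp : (E →L[ℝ] E) → ℝ) := by
  have : (trExp : (E →L[ℝ] E) → ℝ) =
      fun T : E →L[ℝ] E => ∑ i, inner ℝ (stdOrthonormalBasis ℝ E i) ((exp T : E →L[ℝ] E) (stdOrthonormalBasis ℝ E i)) := by
    ext T; exact trExp_eq T _
  rw [this]
  have hc : Continuous (exp : (E →L[ℝ] E) → (E →L[ℝ] E)) := by
    let _ : NormedAlgebra ℚ (E →L[ℝ] E) := NormedAlgebra.restrictScalars ℚ ℝ _
    exact NormedSpace.exp_continuous
  fun_prop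

lemma rankOne_symm (w : E) : ((rankOne ℝ w w : E →L[ℝ] E) : E →ₗ[ℝ] E).IsSymmetric := by
  intro x y
  simp [inner_smul_left, inner_smul_right, real_inner_comm, mul_comm]

lemma add_smul_symm {T S : E →L[ℝ] E} (hT : (T : E →ₗ[ℝ] E).IsSymmetric)
    (hS : (S : E →ₗ[ℝ] E).IsSymmetric) (c : ℝ) :
    ((T + c • S : E →L[ℝ] E) : E →ₗ[ℝ] E).IsSymmetric := by
  intro x y
  have h1 := hT x y
  have h2 := hS x y
  simp only [ContinuousLinearMap.coe_coe] at h1 h2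
  simp [inner_add_left, inner_add_right, inner_smul_left, inner_smul_right, h1, h2]

/-- Klein / Peierls-Bogoliubov inequality in a rank-one direction. -/
lemma trExp_klein (K : E →L[ℝ] E) (hK : (K : E →ₗ[ℝ] E).IsSymmetric) (w : E) (h : ℝ) :
    trExp K + h * inner ℝ w (exp K w) ≤ trExp (K + h • rankOne ℝ w w) := by
  obtain ⟨b, l, h1, h2, h3, h4⟩ := exp_spectral K hK
  have h31 := h3 1
  have h41 := h4 1
  simp only [one_smul, one_mul] at h31 h41
  rw [trExp_eq _ b, trExp_eq _ b, h41, Finset.mul_sum, ← Finset.sum_add_distrib]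
  refine Finset.sum_le_sum fun i _ => ?_
  refine le_trans ?_ (jensen_exp _ (add_smul_symm hK (rankOne_symm w) h) (b i) (b.norm_eq_one i))
  have e1 : inner ℝ (b i) ((K + h • rankOne ℝ w w) (b i)) = l i + h * inner ℝ (b i) w ^ 2 := by
    simp only [_root_.add_apply, _root_.smul_apply, rankOne_apply, h1,
      inner_add_right, inner_smul_right, real_inner_self_eq_norm_sq, b.norm_eq_one]
    rw [real_inner_comm w (b i)]
    ring
  rw [e1, h31, inner_smul_right, real_inner_self_eq_norm_sq, b.norm_eq_one, Real.exp_add]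
  have := Real.add_one_le_exp (h * inner ℝ (b i) w ^ 2)
  nlinarith [Real.exp_pos (l i)]

/-- Growth bound, the key to the rank-one case of Lieb's theorem. -/
lemma exp_growth (K : E →L[ℝ] E) (hK : (K : E →ₗ[ℝ] E).IsSymmetric) (w : E) (hw : ‖w‖ = 1)
    (h : ℝ) (hh : 0 ≤ h) :
    inner ℝ w (exp (K + h • rankOne ℝ w w) w) ≤ Real.exp h * inner ℝ w (exp K w) := by
  set M := K + h • rankOne ℝ w w with hM
  have hMs : (M : E →ₗ[ℝ] E).IsSymmetric := add_smul_symm hK (rankOne_symm w) h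
  set m := inner ℝ w (exp K w) with hm
  have hm0 : 0 < m := exp_quad_pos K hK w hw
  have smulsymm : ∀ (T : E →L[ℝ] E), (T : E →ₗ[ℝ] E).IsSymmetric → ∀ c : ℝ,
      ((c • T : E →L[ℝ] E) : E →ₗ[ℝ] E).IsSymmetric := by
    intro T hT c
    simpa using add_smul_symm (T := 0) (fun x y => by simp) hT c
  set φ : ℝ → ℝ := fun s => inner ℝ w (exp (s • M) w) with hφ
  have hφ0 : ∀ s, 0 < φ s := fun s => exp_quad_pos _ (smulsymm M hMs s) w hw
  have hdM : ∀ s, HasDerivAt (fun s : ℝ => exp (s • M) w) (M (exp (s • M) w)) s := by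
    intro s
    have := (hasDerivAt_exp_smul_const' M s).clm_apply (hasDerivAt_const s w)
    simpa using this
  have hcont : Continuous φ := by
    have : Continuous (fun s : ℝ => exp (s • M) w) :=
      continuous_iff_continuousAt.2 fun s => (hdM s).continuousAt
    fun_prop
  have hcont2 : Continuous (fun s => φ s * (m * Real.exp h) ^ (-s)) := by
    refine hcont.mul (Continuous.rpow continuous_const continuous_neg fun s => Or.inl ?_)
    positivity
  obtain ⟨T, hT, hmax⟩ := isCompact_Icc.exists_isMaxOn (Set.nonempty_Icc.2 (zero_le_one (α := ℝ)))
    hcont2.continuousOn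
  set C := φ T * (m * Real.exp h) ^ (-T) with hC
  have hC0 : 0 ≤ C := by have := hφ0 T; positivity
  have hle : ∀ s ∈ Set.Icc (0 : ℝ) 1, φ s ≤ C * (m ^ s * Real.exp (h * s)) := by
    intro s hs
    have := hmax hs
    simp only [Set.mem_ofPred_eq] at this
    rw [← hC, Real.rpow_neg (by positivity), ← div_eq_mul_inv, div_le_iff₀ (by positivity),
      Real.mul_rpow hm0.le (Real.exp_pos _).le, ← Real.exp_mul] at this
    exact this
  have hCT : φ T = C * (m ^ T * Real.exp (h * T)) := by
    rw [Real.exp_mul, ← Real.mul_rpow hm0.le (Real.exp_pos _).le, hC, mul_assoc,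
      ← Real.rpow_add (by positivity)]
    simp
  -- the interpolating function
  set D : ℝ → ℝ := fun s => inner ℝ w (exp ((T - s) • K) (exp (s • M) w)) with hD
  have hdD : ∀ s, HasDerivAt D (h * inner ℝ w (exp ((T - s) • K) w) * φ s) s := by
    intro s
    have e1 : HasDerivAt (fun s : ℝ => exp ((T - s) • K)) (-(exp ((T - s) • K) * K)) s := by
      have := (hasDerivAt_exp_smul_const K (T - s)).scomp s ((hasDerivAt_id s).const_sub T)
      simpa [Function.comp_def] using this
    have e2 := (hasDerivAt_const s w).inner ℝ (e1.clm_apply (hdM s))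
    refine HasDerivAt.congr_deriv e2 ?_
    simp only [hM, hφ, inner_zero_left, add_zero, inner_add_right, _root_.neg_apply,
      mul_apply_eq_comp, _root_.add_apply, _root_.smul_apply,
      rankOne_apply, map_add, map_smul, inner_neg_right, inner_smul_right]
    ring
  have hanti : MonotoneOn (fun s => C * m ^ T * Real.exp (h * s) - D s) (Set.Icc 0 T) := by
    have hd : ∀ s, HasDerivAt (fun s => C * m ^ T * Real.exp (h * s) - D s)
        (C * m ^ T * (Real.exp (h * s) * h) - h * inner ℝ w (exp ((T - s) • K) w) * φ s) s := by
      intro s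
      have := ((hasDerivAt_id s).const_mul h).exp.const_mul (C * m ^ T)
      have := this.sub (hdD s)
      simp only [id, mul_one] at this
      exact this
    refine monotoneOn_of_deriv_nonneg (convex_Icc 0 T)
      (fun s _ => (hd s).continuousAt.continuousWithinAt)
      (fun s _ => (hd s).differentiableAt.differentiableWithinAt) ?_
    intro s hs
    rw [interior_Icc] at hs
    rw [(hd s).deriv]
    have a1 := exp_quad_rpow K hK w hw (T - s) (by linarith [hs.2]) (by linarith [hs.1, hT.2])
    have a2 := hle s ⟨hs.1.le, by linarith [hs.2, hT.2]⟩
    have a3 : m ^ (T - s) * m ^ s = m ^ T := by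
      rw [← Real.rpow_add hm0]; simp
    have a4 : inner ℝ w (exp ((T - s) • K) w) * φ s ≤
        m ^ (T - s) * (C * (m ^ s * Real.exp (h * s))) :=
      mul_le_mul a1 a2 (hφ0 s).le (by positivity)
    have a5 : m ^ (T - s) * (C * (m ^ s * Real.exp (h * s))) = C * m ^ T * Real.exp (h * s) := by
      rw [← a3]; ring
    rw [a5] at a4
    have := mul_le_mul_of_nonneg_left a4 hh
    linarith
  have h0T := hanti (Set.left_mem_Icc.2 hT.1) (Set.right_mem_Icc.2 hT.1) hT.1
  have hD0 : D 0 ≤ m ^ T := by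
    simpa [hD] using exp_quad_rpow K hK w hw T hT.1 hT.2
  have hDT : D T = C * m ^ T * Real.exp (h * T) := by
    have : D T = φ T := by simp [hD, hφ]
    rw [this, hCT]; ring
  simp only [hDT, mul_zero, Real.exp_zero, mul_one] at h0T
  have hC1 : C ≤ 1 := by
    have : C * m ^ T ≤ 1 * m ^ T := by linarith
    exact le_of_mul_le_mul_right this (by positivity)
  have := hle 1 ⟨zero_le_one, le_refl 1⟩
  simp only [hφ, one_smul, Real.rpow_one, mul_one] at this
  refine this.trans ?_
  calc C * (m * Real.exp h) ≤ 1 * (m * Real.exp h) := by gcongr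
    _ = _ := by ring

lemma trExp_hasDerivAt (K : E →L[ℝ] E) (hK : (K : E →ₗ[ℝ] E).IsSymmetric) (w : E) (x : ℝ) :
    HasDerivAt (fun x : ℝ => trExp (K + x • rankOne ℝ w w))
      (inner ℝ w (exp (K + x • rankOne ℝ w w) w)) x := by
  set G : ℝ → ℝ := fun x => inner ℝ w (exp (K + x • rankOne ℝ w w) w) with hG
  have hGc : Continuous G := by
    have hc : Continuous (exp : (E →L[ℝ] E) → (E →L[ℝ] E)) := by
      let _ : NormedAlgebra ℚ (E →L[ℝ] E) := NormedAlgebra.restrictScalars ℚ ℝ _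
      exact NormedSpace.exp_continuous
    fun_prop
  have hs := fun y => add_smul_symm hK (rankOne_symm w) y
  have key : ∀ x y, trExp (K + x • rankOne ℝ w w) + (y - x) * G x ≤
      trExp (K + y • rankOne ℝ w w) := by
    intro x y
    have := trExp_klein _ (hs x) w (y - x)
    rwa [add_assoc, ← add_smul, add_sub_cancel] at this
  rw [hasDerivAt_iff_isLittleO, Asymptotics.isLittleO_iff]
  intro c hc
  have := Metric.continuous_iff.1 hGc x c hc
  obtain ⟨δ, hδ, hd⟩ := this
  filter_upwards [Metric.ball_mem_nhds x hδ] with y hy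
  have k1 := key x y
  have k2 := key y x
  have k3 := (hd y hy).le
  rw [Real.dist_eq] at k3
  rw [Real.norm_eq_abs, Real.norm_eq_abs, smul_eq_mul, abs_of_nonneg (by linarith)]
  have : trExp (K + y • rankOne ℝ w w) - trExp (K + x • rankOne ℝ w w) - (y - x) * G x ≤
      (G y - G x) * (y - x) := by linarith
  refine this.trans ((le_abs_self _).trans ?_)
  rw [abs_mul]
  gcongr

/-- Rank-one case of Lieb's concavity theorem, two-point form. -/
lemma trExp_two_point (K : E →L[ℝ] E) (hK : (K : E →ₗ[ℝ] E).IsSymmetric) (w : E) (hw : ‖w‖ = 1)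
    (q u : ℝ) (hq0 : 0 ≤ q) (hq1 : q ≤ 1) :
    q * trExp (K + u • rankOne ℝ w w) + (1 - q) * trExp K ≤
      trExp (K + Real.log (1 + q * (Real.exp u - 1)) • rankOne ℝ w w) := by
  have hs := fun y => add_smul_symm hK (rankOne_symm w) y
  have hd : ∀ s : ℝ, 0 < s → HasDerivAt (fun s => trExp (K + Real.log s • rankOne ℝ w w))
      (inner ℝ w (exp (K + Real.log s • rankOne ℝ w w) w) * s⁻¹) s := by
    intro s hs
    exact (trExp_hasDerivAt K hK w (Real.log s)).comp s (Real.hasDerivAt_log hs.ne')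
  have hc : ConcaveOn ℝ (Set.Ioi 0) (fun s => trExp (K + Real.log s • rankOne ℝ w w)) := by
    refine AntitoneOn.concaveOn_of_deriv (convex_Ioi 0)
      (fun s h => (hd s h).continuousAt.continuousWithinAt) ?_ ?_
    · rw [interior_Ioi]
      exact fun s h => (hd s h).differentiableAt.differentiableWithinAt
    · rw [interior_Ioi]
      intro s h s' h' hss
      have h : 0 < s := h
      have h' : 0 < s' := h'
      rw [(hd s h).deriv, (hd s' h').deriv]
      have := exp_growth _ (hs (Real.log s)) w hw (Real.log s' - Real.log s)
        (sub_nonneg.2 (Real.log_le_log h hss))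
      rw [add_assoc, ← add_smul, add_sub_cancel, Real.exp_sub, Real.exp_log h, Real.exp_log h']
        at this
      rw [← div_eq_mul_inv, div_le_iff₀ h']
      calc _ ≤ _ := this
        _ = _ := by field_simp
  have := hc.2 (x := Real.exp u) (y := 1) (Real.exp_pos u) (Set.mem_Ioi.2 one_pos) hq0 (sub_nonneg.2 hq1) (by ring)
  simp only [Real.log_exp, Real.log_one, zero_smul, add_zero, smul_eq_mul, mul_one] at this
  refine this.trans_eq ?_
  congr 4
  ring

end OperatorLemmas

section ScalarLemmas

lemma mono_aux {f f' : ℝ → ℝ} (hd : ∀ x, 0 ≤ x → HasDerivAt f (f' x) x)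
    (hf' : ∀ x, 0 ≤ x → 0 ≤ f' x) (x : ℝ) (hx : 0 ≤ x) : f 0 ≤ f x := by
  have : MonotoneOn f (Set.Ici 0) := by
    refine monotoneOn_of_deriv_nonneg (convex_Ici 0)
      (fun s h => (hd s h).continuousAt.continuousWithinAt) ?_ ?_
    · rw [interior_Ici]
      exact fun s h => (hd s (le_of_lt h)).differentiableAt.differentiableWithinAt
    · rw [interior_Ici]
      intro s h
      rw [(hd s (le_of_lt h)).deriv]
      exact hf' s (le_of_lt h)
  exact this (Set.mem_Ici.2 le_rfl) (Set.mem_Ici.2 hx) hx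

lemma log_mgf_bound (q u : ℝ) (hq0 : 0 ≤ q) (hq1 : q ≤ 1) (hu : 0 ≤ u) :
    Real.log (1 + q * (Real.exp u - 1)) ≤ q * u + q * (1 - q) * (Real.exp u - 1 - u) := by
  have hpos : ∀ x : ℝ, 0 ≤ x → 0 < 1 + q * (Real.exp x - 1) := by
    intro x hx
    have := Real.one_le_exp hx
    nlinarith [mul_nonneg hq0 (sub_nonneg.2 this)]
  have := mono_aux
    (f := fun u => q * u + q * (1 - q) * (Real.exp u - 1 - u)
      - Real.log (1 + q * (Real.exp u - 1)))
    (f' := fun u => q * 1 + q * (1 - q) * (Real.exp u - 1)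
      - (q * Real.exp u) / (1 + q * (Real.exp u - 1))) ?_ ?_ u hu
  · simp at this
    linarith
  · intro x hx
    have e := Real.hasDerivAt_exp x
    exact (((hasDerivAt_id x).const_mul q).add
      (((e.sub_const 1).sub (hasDerivAt_id x)).const_mul (q * (1 - q)))).sub
      ((((e.sub_const 1).const_mul q).const_add 1).log (hpos x hx).ne')
  · intro x hx
    have h1 := Real.one_le_exp hx
    have h2 := hpos x hx
    rw [sub_nonneg, div_le_iff₀ h2]
    obtain ⟨z, hz⟩ : ∃ z, z = Real.exp x - 1 := ⟨_, rfl⟩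
    have hz0 : 0 ≤ z := by linarith
    have hz' : Real.exp x = 1 + z := by linarith
    rw [hz']
    have : 0 ≤ q * (q * (1 - q)) * z ^ 2 := by
      have := sub_nonneg.2 hq1
      positivity
    nlinarith

lemma exp_bernstein (x : ℝ) (hx : 0 ≤ x) :
    2 * (1 - x / 3) * (Real.exp x - 1 - x) ≤ x ^ 2 := by
  have step1 : ∀ x : ℝ, 0 ≤ x →
      0 ≤ 2 * x + 2 / 3 * (Real.exp x - 1 - x) - 2 * (1 - x / 3) * (Real.exp x - 1) := by
    intro x hx
    have := mono_aux
      (f := fun x => 2 * x + 2 / 3 * (Real.exp x - 1 - x) - 2 * (1 - x / 3) * (Real.exp x - 1))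
      (f' := fun x => 2 * 1 + 2 / 3 * (Real.exp x - 1)
        - (2 * (-(1 / 3)) * (Real.exp x - 1) + 2 * (1 - x / 3) * Real.exp x)) ?_ ?_ x hx
    · simpa using this
    · intro x hx
      have e := Real.hasDerivAt_exp x
      have i := hasDerivAt_id x
      exact ((i.const_mul 2).add (((e.sub_const 1).sub i).const_mul (2 / 3))).sub
        ((((i.div_const 3).const_sub 1).const_mul 2).mul (e.sub_const 1))
    · intro x hx
      have h1 : 1 - x ≤ Real.exp (-x) := by linarith [Real.add_one_le_exp (-x)]
      have h2 : Real.exp (-x) * Real.exp x = 1 := by rw [← Real.exp_add]; simp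
      nlinarith [mul_le_mul_of_nonneg_right h1 (Real.exp_pos x).le]
  have := mono_aux
    (f := fun x => x ^ 2 - 2 * (1 - x / 3) * (Real.exp x - 1 - x))
    (f' := fun x => 2 * x - (2 * (-(1 / 3)) * (Real.exp x - 1 - x)
      + 2 * (1 - x / 3) * (Real.exp x - 1))) ?_ ?_ x hx
  · simp at this
    linarith
  · intro x hx
    have e := Real.hasDerivAt_exp x
    have i := hasDerivAt_id x
    have := (hasDerivAt_pow 2 x).sub
      ((((i.div_const 3).const_sub 1).const_mul 2).mul ((e.sub_const 1).sub i))
    refine HasDerivAt.congr_deriv this ?_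
    simp
  · intro x hx
    have := step1 x hx
    linarith

lemma exists_param (q N ell : ℝ) (hq0 : 0 ≤ q) (hq1 : q ≤ 1) (hN : 0 ≤ N) (hell : 0 < ell) :
    ∃ u : ℝ, 0 < u ∧ Real.log (1 + q * (Real.exp u - 1)) / 2 * N -
      u / 2 * (q * N + Real.sqrt (4 * (1 - q) * q * N * ell) + 4 / 3 * ell) ≤ - ell := by
  set V := q * (1 - q) * N with hV
  have hV0 : 0 ≤ V := by have := sub_nonneg.2 hq1; positivity
  have e1 : 4 * (1 - q) * q * N * ell = 4 * V * ell := by rw [hV]; ring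
  rw [e1]
  set s := Real.sqrt (4 * V * ell) with hs
  have hs0 : 0 ≤ s := Real.sqrt_nonneg _
  have hss : s ^ 2 = 4 * V * ell := Real.sq_sqrt (by positivity)
  have red : ∀ u : ℝ, 0 ≤ u → V * (Real.exp u - 1 - u) - u * (s + 4 / 3 * ell) ≤ - (2 * ell) →
      Real.log (1 + q * (Real.exp u - 1)) / 2 * N - u / 2 * (q * N + s + 4 / 3 * ell) ≤ - ell := by
    intro u hu h
    have := mul_le_mul_of_nonneg_right (log_mgf_bound q u hq0 hq1 hu) hN
    have e2 : (q * u + q * (1 - q) * (Real.exp u - 1 - u)) * N =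
      q * u * N + V * (Real.exp u - 1 - u) := by rw [hV]; ring
    rw [e2] at this
    linarith
  rcases hV0.eq_or_lt with h0 | hVp
  · refine ⟨3 / 2, by norm_num, red _ (by norm_num) ?_⟩
    rw [← h0]
    linarith
  · set r := s + 4 / 3 * ell with hr
    have hr0 : 0 < r := by positivity
    have hden : 0 < V + r / 3 := by positivity
    refine ⟨r / (V + r / 3), by positivity, red _ (by positivity) ?_⟩
    set u := r / (V + r / 3) with hu
    have hu0 : 0 < u := by positivity
    have hur : u * (V + r / 3) = r := by rw [hu]; field_simp
    have hu3 : r * (1 - u / 3) = u * V := by linarith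
    have hu3pos : 0 < 1 - u / 3 := by
      by_contra hcon
      push Not at hcon
      nlinarith [mul_pos hu0 hVp]
    have hb := exp_bernstein u hu0.le
    -- V (e^u - 1 - u) ≤ u r / 2
    have hb2 : V * (Real.exp u - 1 - u) ≤ u * r / 2 := by
      have : (1 - u / 3) * (V * (Real.exp u - 1 - u)) ≤ (1 - u / 3) * (u * r / 2) := by
        have e3 : (1 - u / 3) * (u * r / 2) = V * u ^ 2 / 2 := by
          linear_combination (u / 2) * hu3
        rw [e3]
        nlinarith
      exact le_of_mul_le_mul_left this hu3pos
    -- u r ≥ 4 ell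
    have hb3 : 4 * ell ≤ u * r := by
      rw [hu, div_mul_eq_mul_div, le_div_iff₀ hden]
      have : r * r = s ^ 2 + s * (4 / 3 * ell) + 4 / 3 * ell * r := by rw [hr]; ring
      rw [this, hss]
      nlinarith [mul_nonneg hs0 hell.le]
    linarith

end ScalarLemmas

section ExpectationLemmas

open NormedSpace InnerProductSpace

variable {E : Type*} [NormedAddCommGroup E] [InnerProductSpace ℝ E] [FiniteDimensional ℝ E]

lemma trExp_nonneg (T : E →L[ℝ] E) (hT : (T : E →ₗ[ℝ] E).IsSymmetric) : 0 ≤ trExp T := by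
  rw [trExp_eq T (stdOrthonormalBasis ℝ E)]
  exact Finset.sum_nonneg fun i _ => (exp_quad_pos T hT _ (OrthonormalBasis.norm_eq_one _ i)).le

lemma sum_symm {ι : Type*} (S : Finset ι) (T : ι → E →L[ℝ] E)
    (hT : ∀ i, (T i : E →ₗ[ℝ] E).IsSymmetric) (c : ι → ℝ) {K : E →L[ℝ] E}
    (hK : (K : E →ₗ[ℝ] E).IsSymmetric) :
    ((K + ∑ i ∈ S, c i • T i : E →L[ℝ] E) : E →ₗ[ℝ] E).IsSymmetric := by
  induction S using Finset.induction_on with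
  | empty => simpa using hK
  | insert a S ha ih =>
    rw [Finset.sum_insert ha, add_comm (c a • T a), ← add_assoc]
    exact add_smul_symm ih (hT a) _

lemma expect_trExp {Ω ι : Type*} [MeasurableSpace Ω] (μ : Measure Ω) [IsProbabilityMeasure μ]
    (X : ι → Ω → ℝ) (hX : ∀ i, Measurable (X i)) (hX01 : ∀ i ω, X i ω = 0 ∨ X i ω = 1)
    (p : ℝ) (hp0 : 0 ≤ p) (hp1 : p ≤ 1) (hXp : ∀ i, μ {ω | X i ω = 1} = ENNReal.ofReal p)
    (hind : iIndepFun X μ) (w : ι → E) (hw : ∀ i, ‖w i‖ = 1) (u : ℝ) (S : Finset ι) :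
    ∀ K : E →L[ℝ] E, (K : E →ₗ[ℝ] E).IsSymmetric →
    ∫⁻ ω, ENNReal.ofReal (trExp (K + ∑ i ∈ S, (u * (1 - X i ω)) • rankOne ℝ (w i) (w i))) ∂μ ≤
      ENNReal.ofReal (trExp (K + ∑ i ∈ S,
        Real.log (1 + (1 - p) * (Real.exp u - 1)) • rankOne ℝ (w i) (w i))) := by
  induction S using Finset.induction_on with
  | empty => intro K hK; simp
  | insert e S he ih =>
    intro K hK
    set g := Real.log (1 + (1 - p) * (Real.exp u - 1)) with hg
    set R : ι → E →L[ℝ] E := fun i => rankOne ℝ (w i) (w i) with hR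
    have hRs : ∀ i, (R i : E →ₗ[ℝ] E).IsSymmetric := fun i => rankOne_symm (w i)
    -- the value of the functional when the coefficient at `e` is `c`
    set F : ℝ → (S → ℝ) → ENNReal := fun c x =>
      ENNReal.ofReal (trExp (K + c • R e + ∑ i : S, (u * (1 - x i)) • R i)) with hF
    have hFm : ∀ c, Measurable (F c) := by
      intro c
      refine ENNReal.measurable_ofReal.comp (Continuous.measurable ?_)
      exact continuous_trExp.comp (by fun_prop)
    set Y : Ω → (S → ℝ) := fun ω i => X i ω with hY
    have hYm : Measurable Y := measurable_pi_lambda _ fun i => hX i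
    have hFY : ∀ c ω, F c (Y ω) =
        ENNReal.ofReal (trExp (K + c • R e + ∑ i ∈ S, (u * (1 - X i ω)) • R i)) := by
      intro c ω
      simp only [hF, hY]
      rw [Finset.sum_coe_sort S (fun i => (u * (1 - X i ω)) • R i)]
    have hindY : IndepFun (X e) Y μ := by
      have := hind.indepFun_finset {e} S (by simpa using he) hX
      have hφ : Measurable (fun x : (({e} : Finset ι) → ℝ) => x ⟨e, by simp⟩) :=
        measurable_pi_apply _
      exact this.comp hφ measurable_id
    have hIX : ∫⁻ ω, ENNReal.ofReal (X e ω) ∂μ = ENNReal.ofReal p := by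
      have hm : MeasurableSet {ω | X e ω = 1} := hX e (measurableSet_singleton 1)
      rw [← hXp e, ← lintegral_indicator_one hm]
      refine lintegral_congr fun ω => ?_
      rcases hX01 e ω with h | h <;> simp [Set.indicator, h]
    have hIX' : ∫⁻ ω, ENNReal.ofReal (1 - X e ω) ∂μ = ENNReal.ofReal (1 - p) := by
      have hm : MeasurableSet {ω | X e ω = 1} := hX e (measurableSet_singleton 1)
      have h1 : μ {ω | X e ω = 1}ᶜ = ENNReal.ofReal (1 - p) := by
        rw [prob_compl_eq_one_sub hm, hXp e, ENNReal.ofReal_sub _ hp0, ENNReal.ofReal_one]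
      rw [← h1, ← lintegral_indicator_one hm.compl]
      refine lintegral_congr fun ω => ?_
      rcases hX01 e ω with h | h <;> simp [Set.indicator, h]
    have split : ∀ ω, ENNReal.ofReal (trExp (K + ∑ i ∈ insert e S, (u * (1 - X i ω)) • R i)) =
        ENNReal.ofReal (1 - X e ω) * F u (Y ω) + ENNReal.ofReal (X e ω) * F 0 (Y ω) := by
      intro ω
      rw [Finset.sum_insert he, ← add_assoc, hFY, hFY]
      rcases hX01 e ω with h | h <;> simp [h]
    have m1 : Measurable fun ω => ENNReal.ofReal (1 - X e ω) := by
      have := hX e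
      fun_prop
    have m2 : Measurable fun ω => ENNReal.ofReal (X e ω) := by
      have := hX e
      fun_prop
    have m3 : ∀ c, Measurable fun ω => F c (Y ω) := fun c => (hFm c).comp hYm
    have i1 : ∫⁻ ω, ENNReal.ofReal (1 - X e ω) * F u (Y ω) ∂μ =
        ENNReal.ofReal (1 - p) * ∫⁻ ω, F u (Y ω) ∂μ := by
      rw [← hIX']
      refine lintegral_mul_eq_lintegral_mul_lintegral_of_indepFun m1 (m3 u) ?_
      exact hindY.comp (φ := fun x : ℝ => ENNReal.ofReal (1 - x)) (ψ := F u)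
        (by fun_prop) (hFm u)
    have i2 : ∫⁻ ω, ENNReal.ofReal (X e ω) * F 0 (Y ω) ∂μ =
        ENNReal.ofReal p * ∫⁻ ω, F 0 (Y ω) ∂μ := by
      rw [← hIX]
      refine lintegral_mul_eq_lintegral_mul_lintegral_of_indepFun m2 (m3 0) ?_
      exact hindY.comp (φ := fun x : ℝ => ENNReal.ofReal x) (ψ := F 0)
        (by fun_prop) (hFm 0)
    calc ∫⁻ ω, ENNReal.ofReal (trExp (K + ∑ i ∈ insert e S, (u * (1 - X i ω)) • R i)) ∂μ
        = ∫⁻ ω, (ENNReal.ofReal (1 - X e ω) * F u (Y ω)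
            + ENNReal.ofReal (X e ω) * F 0 (Y ω)) ∂μ := lintegral_congr split
      _ = ENNReal.ofReal (1 - p) * ∫⁻ ω, F u (Y ω) ∂μ
            + ENNReal.ofReal p * ∫⁻ ω, F 0 (Y ω) ∂μ := by
          rw [← i1, ← i2]
          exact lintegral_add_left (m1.mul (m3 u)) _
      _ = ∫⁻ ω, (ENNReal.ofReal (1 - p) * F u (Y ω) + ENNReal.ofReal p * F 0 (Y ω)) ∂μ := by
          rw [lintegral_add_left ((m3 u).const_mul _), lintegral_const_mul _ (m3 u),
            lintegral_const_mul _ (m3 0)]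
      _ ≤ ∫⁻ ω, ENNReal.ofReal
            (trExp ((K + g • R e) + ∑ i ∈ S, (u * (1 - X i ω)) • R i)) ∂μ := by
          refine lintegral_mono fun ω => ?_
          simp only [hFY]
          set Q := K + ∑ i ∈ S, (u * (1 - X i ω)) • R i with hQ
          have hQs : (Q : E →ₗ[ℝ] E).IsSymmetric := sum_symm S R hRs _ hK
          have hc : ∀ c : ℝ, K + c • R e + ∑ i ∈ S, (u * (1 - X i ω)) • R i = Q + c • R e := by
            intro c; rw [hQ]; abel
          simp only [hc]
          have h2 := trExp_two_point Q hQs (w e) (hw e) (1 - p) u (by linarith) (by linarith)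
          rw [sub_sub_cancel] at h2
          have n1 := trExp_nonneg _ (add_smul_symm hQs (hRs e) u)
          have n2 := trExp_nonneg _ hQs
          rw [zero_smul, add_zero, ← ENNReal.ofReal_mul (by linarith), ← ENNReal.ofReal_mul hp0,
            ← ENNReal.ofReal_add (mul_nonneg (by linarith) n1) (mul_nonneg hp0 n2)]
          exact ENNReal.ofReal_le_ofReal h2
      _ ≤ ENNReal.ofReal (trExp ((K + g • R e) + ∑ i ∈ S, g • R i)) :=
          ih _ (add_smul_symm hK (hRs e) g)
      _ = _ := by rw [Finset.sum_insert he, ← add_assoc]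

/-- Upper bound for the trace exponential. -/
lemma trExp_smul_le (T : E →L[ℝ] E) (hT : (T : E →ₗ[ℝ] E).IsSymmetric) (c : ℝ) (hc : 0 ≤ c) :
    trExp (c • T) ≤ Module.finrank ℝ E * Real.exp (c * ‖T‖) := by
  obtain ⟨b, l, h1, h2, h3, h4⟩ := exp_spectral T hT
  rw [trExp_eq _ b]
  have : ∀ i ∈ Finset.univ, inner ℝ (b i) (exp (c • T) (b i)) ≤ Real.exp (c * ‖T‖) := by
    intro i _
    rw [h3, inner_smul_right, real_inner_self_eq_norm_sq, b.norm_eq_one, one_pow, mul_one]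
    refine Real.exp_le_exp.2 (mul_le_mul_of_nonneg_left ?_ hc)
    have := T.le_opNorm (b i)
    rw [h1, norm_smul, b.norm_eq_one, mul_one, mul_one] at this
    exact (le_abs_self _).trans this
  simpa using Finset.sum_le_sum this

/-- Lower bound for the trace exponential of a nonnegative operator. -/
lemma exp_le_trExp (T : E →L[ℝ] E) (hT : (T : E →ₗ[ℝ] E).IsSymmetric)
    (hpos : ∀ x, 0 ≤ inner ℝ x (T x)) (c t : ℝ) (hc : 0 ≤ c) (ht0 : 0 ≤ t) (ht : t < ‖T‖) :
    Real.exp (c * t) ≤ trExp (c • T) := by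
  obtain ⟨b, l, h1, h2, h3, h4⟩ := exp_spectral T hT
  have hl0 : ∀ i, 0 ≤ l i := by
    intro i
    have := hpos (b i)
    rwa [h1, inner_smul_right, real_inner_self_eq_norm_sq, b.norm_eq_one, one_pow, mul_one] at this
  have hex : ∃ i, t < l i := by
    by_contra hcon
    push Not at hcon
    refine absurd ht (not_lt.2 (T.opNorm_le_bound ht0 fun x => ?_))
    have e1 : ∀ i, inner ℝ (b i) (T x) = l i * inner ℝ (b i) x := by
      intro i
      have := hT (b i) x
      simp only [ContinuousLinearMap.coe_coe] at this
      rw [← this, h1, inner_smul_left]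
      simp
    have e2 : ‖T x‖ ^ 2 ≤ (t * ‖x‖) ^ 2 := by
      rw [mul_pow, ← b.sum_sq_inner_right, ← b.sum_sq_inner_right x, Finset.mul_sum]
      refine Finset.sum_le_sum fun i _ => ?_
      rw [e1, mul_pow]
      have := pow_le_pow_left₀ (hl0 i) (hcon i) 2
      exact mul_le_mul_of_nonneg_right this (sq_nonneg _)
    exact le_of_sq_le_sq e2 (by positivity)
  obtain ⟨i, hi⟩ := hex
  rw [trExp_eq _ b]
  have e3 : ∀ i, inner ℝ (b i) (exp (c • T) (b i)) = Real.exp (c * l i) := by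
    intro i
    rw [h3, inner_smul_right, real_inner_self_eq_norm_sq, b.norm_eq_one, one_pow, mul_one]
  simp only [e3]
  refine le_trans (Real.exp_le_exp.2 (mul_le_mul_of_nonneg_left hi.le hc)) ?_
  exact Finset.single_le_sum (f := fun i => Real.exp (c * l i)) (fun i _ => (Real.exp_pos _).le)
    (Finset.mem_univ i)

end ExpectationLemmas

section GraphLemmas

open InnerProductSpace

/-- The normalised edge vector. -/
noncomputable def edgeVec {n : ℕ} (i j : Fin n) : EuclideanSpace ℝ (Fin n) :=
  (Real.sqrt 2)⁻¹ • (EuclideanSpace.single i (1 : ℝ) - EuclideanSpace.single j 1)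

lemma edgeVec_norm {n : ℕ} (i j : Fin n) (h : i ≠ j) : ‖edgeVec i j‖ = 1 := by
  have h1 : ‖(EuclideanSpace.single i (1 : ℝ) - EuclideanSpace.single j 1)‖ ^ 2 = 2 := by
    rw [norm_sub_sq_real]
    rw [EuclideanSpace.inner_single_left]
    simp [h]
    norm_num
  have h2 : ‖(EuclideanSpace.single i (1 : ℝ) - EuclideanSpace.single j 1)‖ = Real.sqrt 2 := by
    rw [← h1, Real.sqrt_sq (norm_nonneg _)]
  rw [edgeVec, norm_smul, h2, norm_inv, Real.norm_of_nonneg (Real.sqrt_nonneg _)]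
  exact inv_mul_cancel₀ (by positivity)

lemma edgeMat_clm {n : ℕ} (i j : Fin n) :
    Matrix.toEuclideanCLM (𝕜 := ℝ) (edgeMat i j) =
      (2 : ℝ) • rankOne ℝ (edgeVec i j) (edgeVec i j) := by
  ext x k
  have hs : (Real.sqrt 2)⁻¹ * (Real.sqrt 2)⁻¹ = 1 / 2 := by
    rw [← mul_inv, Real.mul_self_sqrt (by norm_num)]; norm_num
  have h1 : (Matrix.toEuclideanCLM (𝕜 := ℝ) (edgeMat i j)) x k =
      ((if k = i then (1 : ℝ) else 0) - (if k = j then 1 else 0)) * (x i - x j) := by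
    rw [Matrix.ofLp_toEuclideanCLM, edgeMat, Matrix.vecMulVec_mulVec]
    simp [dotProduct, sub_mul, Finset.sum_sub_distrib]
  rw [h1]
  have h2 : inner ℝ (edgeVec i j) x = (Real.sqrt 2)⁻¹ * (x i - x j) := by
    rw [edgeVec, inner_smul_left, inner_sub_left, EuclideanSpace.inner_single_left,
      EuclideanSpace.inner_single_left]
    simp
  have h3 : edgeVec i j k =
      (Real.sqrt 2)⁻¹ * ((if k = i then (1 : ℝ) else 0) - (if k = j then 1 else 0)) := by
    simp [edgeVec]
  simp only [_root_.smul_apply, rankOne_apply, PiLp.smul_apply, smul_eq_mul]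
  rw [h2, h3]
  linear_combination (-2 * (x i - x j) *
    ((if k = i then (1 : ℝ) else 0) - (if k = j then 1 else 0))) * hs

lemma sum_pairs {n : ℕ} (f : Fin n → Fin n → ℝ) (hs : ∀ i j, f i j = f j i)
    (hd : ∀ i, f i i = 0) : ∑ i, ∑ j, f i j = 2 * ∑ p ∈ pairs n, f p.1 p.2 := by
  have e1 : ∑ p ∈ pairs n, f p.1 p.2 = ∑ i, ∑ j, if i < j then f i j else 0 := by
    rw [pairs, Finset.sum_filter, ← Finset.univ_product_univ, Finset.sum_product]
  have e2 : ∑ p ∈ pairs n, f p.1 p.2 = ∑ i, ∑ j, if j < i then f i j else 0 := by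
    rw [e1, Finset.sum_comm]
    refine Finset.sum_congr rfl fun i _ => Finset.sum_congr rfl fun j _ => ?_
    rw [hs]
  rw [two_mul]
  nth_rw 1 [e1]
  rw [e2, ← Finset.sum_add_distrib]
  refine Finset.sum_congr rfl fun i _ => ?_
  rw [← Finset.sum_add_distrib]
  refine Finset.sum_congr rfl fun j _ => ?_
  rcases lt_trichotomy i j with h | h | h
  · simp [h, h.not_gt]
  · simp [h, hd]
  · simp [h, h.not_gt]

lemma lap_eq {n : ℕ} (A : Matrix (Fin n) (Fin n) ℝ) (hAsymm : A.IsSymm)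
    (hAdiag : ∀ i, A i i = 0) : lap A = ∑ p ∈ pairs n, A p.1 p.2 • edgeMat p.1 p.2 := by
  ext k l
  have hsy : ∀ i j, A i j = A j i := fun i j => hAsymm.apply j i
  have h := sum_pairs (fun i j => A i j * edgeMat i j k l)
    (fun i j => by simp only [edgeMat, Matrix.vecMulVec_apply]; rw [hsy i j]; ring)
    (fun i => by simp [hAdiag])
  rw [Matrix.sum_apply]
  simp only [Matrix.smul_apply, smul_eq_mul]
  have h2 : ∑ i, ∑ j, A i j * edgeMat i j k l = 2 * lap A k l := by
    have e : ∀ i j, A i j * edgeMat i j k l =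
        (if k = i then (if l = i then A i j else 0) else 0)
        - (if k = i then (if l = j then A i j else 0) else 0)
        - (if l = i then (if k = j then A i j else 0) else 0)
        + (if k = j then (if l = j then A i j else 0) else 0) := by
      intro i j
      simp only [edgeMat, Matrix.vecMulVec_apply]
      split_ifs <;> ring
    simp only [e, Finset.sum_add_distrib, Finset.sum_sub_distrib]
    have f1 : ∑ i, ∑ j, (if k = i then (if l = i then A i j else 0) else 0) =
        if l = k then ∑ j, A k j else 0 := by
      rw [Finset.sum_eq_single k (fun b _ hb => by simp [hb.symm]) (by simp)]
      split_ifs <;> simp_all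
    have f2 : ∑ i, ∑ j, (if k = i then (if l = j then A i j else 0) else 0) = A k l := by
      rw [Finset.sum_eq_single k (fun b _ hb => by simp [hb.symm]) (by simp)]
      simp
    have f3 : ∑ i, ∑ j, (if l = i then (if k = j then A i j else 0) else 0) = A k l := by
      rw [Finset.sum_eq_single l (fun b _ hb => by simp [hb.symm]) (by simp)]
      simp [hsy]
    have f4 : ∑ i, ∑ j, (if k = j then (if l = j then A i j else 0) else 0) =
        if l = k then ∑ j, A k j else 0 := by
      rw [Finset.sum_comm]
      rw [Finset.sum_eq_single k (fun b _ hb => by simp [hb.symm]) (by simp)]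
      by_cases hlk : l = k
      · simp only [hlk, if_true]
        exact Finset.sum_congr rfl fun i _ => hsy i k
      · simp [hlk]
    rw [f1, f2, f3, f4, lap, Matrix.sub_apply, Matrix.diagonal_apply]
    by_cases hkl : k = l
    · simp only [hkl, if_true]; ring
    · simp only [hkl, Ne.symm hkl, if_false]; ring
  rw [h2] at h
  linarith

lemma smul_sub_aux {E : Type*} [NormedAddCommGroup E] [InnerProductSpace ℝ E] (b : ℝ)
    (T : E →L[ℝ] E) : (2 * b) • T - (2 : ℝ) • T = -((2 * (1 - b)) • T) := by
  rw [← sub_smul, ← neg_smul]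
  congr 1
  ring

lemma smul_zero_aux {E : Type*} [NormedAddCommGroup E] [InnerProductSpace ℝ E] (a c : ℝ)
    (h : a = 0) (T : E →L[ℝ] E) : (a * c) • (2 : ℝ) • T = 0 := by
  simp [h]

lemma smul_one_aux {E : Type*} [NormedAddCommGroup E] [InnerProductSpace ℝ E] (a c : ℝ)
    (h : a = 1) (T : E →L[ℝ] E) : (a * c) • (2 : ℝ) • T = (2 * c) • T := by
  rw [smul_smul, h]
  congr 1
  ring

end GraphLemmas

/-- High-probability bound on the Laplacian deviation of the
edge-subsampled graph: with probability at least 1 − η,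
‖ΔL‖₂ ≤ (1 − p_s)‖L‖₂ + √(4 p_s(1 − p_s)‖L‖₂ log(2n/η)) + (4/3) log(2n/η). -/
theorem deltaL_spectral_bound {n : ℕ}
    (A : Matrix (Fin n) (Fin n) ℝ)
    (hA01 : ∀ i j, A i j = 0 ∨ A i j = 1) (hAsymm : A.IsSymm) (hAdiag : ∀ i, A i i = 0)
    {Ω : Type} [MeasurableSpace Ω] (μ : Measure Ω) [IsProbabilityMeasure μ]
    (ps : ℝ) (hps0 : 0 < ps) (hps1 : ps ≤ 1)
    (B : Fin n → Fin n → Ω → ℝ)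
    (hBmeas : ∀ i j, Measurable (B i j))
    (hB01 : ∀ i j ω, B i j ω = 0 ∨ B i j ω = 1)
    (hBp : ∀ i j, μ {ω | B i j ω = 1} = ENNReal.ofReal ps)
    (hBindep : iIndepFun
      (fun p : {p : Fin n × Fin n // p.1 < p.2} => B p.1.1 p.1.2) μ)
    (η : ℝ) (hη0 : 0 < η) (hη1 : η < 1) :
    μ {ω | specNorm (lapHat A B ω - lap A)
          ≤ (1 - ps) * specNorm (lap A)
            + Real.sqrt (4 * ps * (1 - ps) * specNorm (lap A) * Real.log (2 * n / η))
            + 4 / 3 * Real.log (2 * n / η)} ≥ ENNReal.ofReal (1 - η) := by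
  rcases Nat.eq_zero_or_pos n with hn | hn
  · subst hn
    have h0 : ∀ M : Matrix (Fin 0) (Fin 0) ℝ, specNorm M = 0 := by
      intro M
      rw [Subsingleton.elim M 0, specNorm, map_zero, norm_zero]
    simp only [h0]
    simp
    linarith
  set ι := {p : Fin n × Fin n // p.1 < p.2} with hι
  set X : ι → Ω → ℝ := fun p => B p.1.1 p.1.2 with hX
  set w : ι → EuclideanSpace ℝ (Fin n) := fun p => edgeVec p.1.1 p.1.2 with hw
  have hw1 : ∀ p, ‖w p‖ = 1 := fun p => edgeVec_norm _ _ p.2.ne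
  set R : ι → EuclideanSpace ℝ (Fin n) →L[ℝ] EuclideanSpace ℝ (Fin n) :=
    fun p => InnerProductSpace.rankOne ℝ (w p) (w p) with hR
  have hRs : ∀ p, (R p : EuclideanSpace ℝ (Fin n) →ₗ[ℝ] EuclideanSpace ℝ (Fin n)).IsSymmetric :=
    fun p => rankOne_symm _
  have hzero : ((0 : EuclideanSpace ℝ (Fin n) →L[ℝ] EuclideanSpace ℝ (Fin n)) :
      EuclideanSpace ℝ (Fin n) →ₗ[ℝ] EuclideanSpace ℝ (Fin n)).IsSymmetric := fun x y => by simp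
  set S : Finset ι := Finset.univ.filter (fun p => A p.1.1 p.1.2 = 1) with hS
  have conv : ∀ c : Fin n → Fin n → ℝ,
      Matrix.toEuclideanCLM (𝕜 := ℝ) (∑ p ∈ pairs n, (A p.1 p.2 * c p.1 p.2) • edgeMat p.1 p.2) =
      ∑ p ∈ S, (2 * c p.1.1 p.1.2) • R p := by
    intro c
    rw [map_sum, Finset.sum_subtype (pairs n) (p := fun p => p.1 < p.2) (by simp [pairs]),
      hS, Finset.sum_filter]
    refine Finset.sum_congr rfl fun p _ => ?_
    rw [map_smul, edgeMat_clm]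
    rcases hA01 p.1.1 p.1.2 with h | h
    · rw [if_neg (by rw [h]; norm_num)]
      exact smul_zero_aux _ _ h _
    · rw [if_pos h]
      exact smul_one_aux _ _ h _
  have hlap : Matrix.toEuclideanCLM (𝕜 := ℝ) (lap A) = ∑ p ∈ S, (2 : ℝ) • R p := by
    have := conv (fun _ _ => 1)
    simp only [mul_one] at this
    rw [lap_eq A hAsymm hAdiag, this]
  have hdiff : ∀ ω, Matrix.toEuclideanCLM (𝕜 := ℝ) (lapHat A B ω - lap A) =
      - ∑ p ∈ S, (2 * (1 - X p ω)) • R p := by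
    intro ω
    rw [map_sub, hlap, lapHat, conv (fun i j => B i j ω), ← Finset.sum_sub_distrib,
      ← Finset.sum_neg_distrib]
    refine Finset.sum_congr rfl fun p _ => ?_
    exact smul_sub_aux _ _
  set N := specNorm (lap A) with hN
  have hN0 : 0 ≤ N := norm_nonneg _
  set ell := Real.log (2 * n / η) with hell
  have hn1 : (1 : ℝ) ≤ n := by exact_mod_cast hn
  have hell0 : 0 < ell := by
    apply Real.log_pos
    rw [lt_div_iff₀ hη0]
    linarith
  obtain ⟨u, hu0, hu⟩ := exists_param (1 - ps) N ell (by linarith) (by linarith) hN0 hell0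
  rw [sub_sub_cancel] at hu
  set t := (1 - ps) * N + Real.sqrt (4 * ps * (1 - ps) * N * ell) + 4 / 3 * ell with ht
  have ht0 : 0 ≤ t := by
    have := mul_nonneg (sub_nonneg.2 hps1) hN0
    positivity
  set g := Real.log (1 + (1 - ps) * (Real.exp u - 1)) with hg
  have hg0 : 0 ≤ g := by
    apply Real.log_nonneg
    have := mul_nonneg (sub_nonneg.2 hps1) (sub_nonneg.2 (Real.one_le_exp hu0.le))
    linarith
  have hexp := expect_trExp μ X (fun p => hBmeas _ _) (fun p => hB01 _ _) ps hps0.le hps1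
    (fun p => hBp _ _) hBindep w hw1 u S 0 hzero
  simp only [zero_add] at hexp
  set Z : Ω → ENNReal := fun ω => ENNReal.ofReal (trExp (∑ p ∈ S, (u * (1 - X p ω)) • R p)) with hZ
  have hZm : Measurable Z := by
    refine ENNReal.measurable_ofReal.comp ?_
    have hc : Continuous fun x : ι → ℝ => trExp (∑ p ∈ S, (u * (1 - x p)) • R p) :=
      continuous_trExp.comp (by fun_prop)
    exact hc.measurable.comp (measurable_pi_lambda (fun ω p => X p ω) fun p => hBmeas _ _)
  have hub : trExp (∑ p ∈ S, g • R p) ≤ n * Real.exp (g / 2 * N) := by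
    have e1 : ∑ p ∈ S, g • R p = (g / 2) • Matrix.toEuclideanCLM (𝕜 := ℝ) (lap A) := by
      rw [hlap, Finset.smul_sum]
      refine Finset.sum_congr rfl fun p _ => ?_
      rw [smul_smul]
      congr 1
      ring
    rw [e1]
    have hs : ((Matrix.toEuclideanCLM (𝕜 := ℝ) (lap A)) :
        EuclideanSpace ℝ (Fin n) →ₗ[ℝ] EuclideanSpace ℝ (Fin n)).IsSymmetric := by
      rw [hlap]
      have := sum_symm S R hRs (fun _ => 2) hzero
      rwa [zero_add] at this
    have := trExp_smul_le _ hs (g / 2) (by positivity)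
    rw [finrank_euclideanSpace_fin] at this
    exact this
  have hlb : ∀ ω, t < specNorm (lapHat A B ω - lap A) →
      ENNReal.ofReal (Real.exp (u / 2 * t)) ≤ Z ω := by
    intro ω hω
    rw [specNorm, hdiff, norm_neg] at hω
    have hs := sum_symm S R hRs (fun p => 2 * (1 - X p ω)) hzero
    rw [zero_add] at hs
    have h := exp_le_trExp _ hs ?_ (u / 2) t (by positivity) ht0 hω
    · refine ENNReal.ofReal_le_ofReal (h.trans_eq ?_)
      rw [Finset.smul_sum]
      congr 1
      refine Finset.sum_congr rfl fun p _ => ?_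
      rw [smul_smul]
      congr 1
      ring
    · intro x
      rw [_root_.sum_apply, inner_sum]
      refine Finset.sum_nonneg fun p _ => ?_
      have hx : 0 ≤ 1 - X p ω := by
        rcases hB01 p.1.1 p.1.2 ω with h | h <;> simp [hX, h]
      simp only [hR, _root_.smul_apply, InnerProductSpace.rankOne_apply, inner_smul_right]
      rw [real_inner_comm (w p) x]
      have := mul_self_nonneg (inner ℝ (w p) x)
      positivity
  set G := {ω | Z ω < ENNReal.ofReal (Real.exp (u / 2 * t))} with hG
  have hGm : MeasurableSet G := measurableSet_lt hZm measurable_const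
  have hbad : μ Gᶜ ≤ ENNReal.ofReal η := by
    have h1 := mul_meas_ge_le_lintegral (μ := μ) hZm (ENNReal.ofReal (Real.exp (u / 2 * t)))
    have hGc : Gᶜ = {ω | ENNReal.ofReal (Real.exp (u / 2 * t)) ≤ Z ω} := by
      ext ω; simp [hG]
    rw [← hGc] at h1
    have h2 := (h1.trans hexp).trans (ENNReal.ofReal_le_ofReal hub)
    have h3 : (n : ℝ) * Real.exp (g / 2 * N) ≤ Real.exp (u / 2 * t) * η := by
      have e1 : g / 2 * N ≤ u / 2 * t + - ell := by linarith
      have e2 : Real.exp (-ell) = η / (2 * n) := by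
        rw [Real.exp_neg, hell, Real.exp_log (by positivity), inv_div]
      calc (n : ℝ) * Real.exp (g / 2 * N) ≤ n * Real.exp (u / 2 * t + - ell) := by gcongr
        _ = Real.exp (u / 2 * t) * (η / 2) := by
          rw [Real.exp_add, e2]; field_simp
        _ ≤ _ := by gcongr; linarith
    have h4 := h2.trans (ENNReal.ofReal_le_ofReal h3)
    rw [ENNReal.ofReal_mul (Real.exp_pos _).le] at h4
    exact (ENNReal.mul_le_mul_iff_right (by simp [Real.exp_pos]) ENNReal.ofReal_ne_top).1 h4
  have hgood : ENNReal.ofReal (1 - η) ≤ μ G := by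
    rw [ENNReal.ofReal_sub _ hη0.le, ENNReal.ofReal_one, ← compl_compl G,
      prob_compl_eq_one_sub hGm.compl]
    exact tsub_le_tsub_left hbad 1
  refine hgood.trans (measure_mono fun ω hω => ?_)
  by_contra hcon
  exact absurd hω (not_lt.2 (hlb ω (not_le.1 hcon)))
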